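/- arXiv:1704.05837 — 5 statements merged into one kernel-verified Lean document; each statement's English description precedes it below -/
import Mathlib

section
/- Let H be a finite-dimensional complex inner product space and let V and W be subspaces of H with dim V = dim W. Then sup over unit vectors v ∈ V of the distance from v to W equals sup over unit vectors w ∈ W of the distance from w to V; in particular, if every unit vector of V is within distance ε of W, then every unit vector of W is within distance ε of V. -/
namespace Submodule

variable {𝕜 E : Type*} [RCLike 𝕜] [NormedAddCommGroup E] [InnerProductSpace 𝕜 E]

theorem infDist_sq_eq_norm_sq_sub (U : Submodule 𝕜 E) [U.HasOrthogonalProjection] (x : E) :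
    Metric.infDist x (U : Set E) ^ 2 = ‖x‖ ^ 2 - ‖U.starProjection x‖ ^ 2 := by
  have h : Metric.infDist x (U : Set E) = ‖x - U.starProjection x‖ := by
    simp only [Metric.infDist_eq_iInf, starProjection_minimal, dist_eq_norm]
    rfl
  rw [h, ← starProjection_orthogonal_val, U.norm_sq_eq_add_norm_sq_starProjection x]
  ring

theorem infDist_le_norm (U : Submodule 𝕜 E) (x : E) : Metric.infDist x (U : Set E) ≤ ‖x‖ := by
  simpa using Metric.infDist_le_dist_of_mem (x := x) U.zero_mem

/-- If every unit vector of `V` is within `ε` of `U`, then the orthogonal projection onto `U`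
shrinks the squared norms of the vectors of `V` by a factor of at least `1 - ε ^ 2`. -/
theorem mul_norm_sq_le_norm_starProjection_sq {V U : Submodule 𝕜 E} [U.HasOrthogonalProjection]
    {ε : ℝ} (h : ∀ v ∈ V, ‖v‖ = 1 → Metric.infDist v (U : Set E) ≤ ε) {v : E} (hv : v ∈ V) :
    (1 - ε ^ 2) * ‖v‖ ^ 2 ≤ ‖U.starProjection v‖ ^ 2 := by
  rcases eq_or_ne v 0 with rfl | hv0
  · simp
  have hpos : 0 < ‖v‖ := norm_pos_iff.mpr hv0
  have hu := h (((‖v‖ : 𝕜)⁻¹) • v) (V.smul_mem _ hv) (norm_smul_inv_norm hv0)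
  have hsq := pow_le_pow_left₀ Metric.infDist_nonneg hu 2
  rw [infDist_sq_eq_norm_sq_sub, norm_smul_inv_norm hv0, map_smul, norm_smul, norm_inv,
    RCLike.norm_ofReal, abs_of_pos hpos, mul_pow, inv_pow] at hsq
  have hle : 1 - ε ^ 2 ≤ ‖U.starProjection v‖ ^ 2 / ‖v‖ ^ 2 := by
    rw [div_eq_inv_mul]
    linarith
  rwa [le_div_iff₀ (by positivity)] at hle

theorem infDist_le_of_finrank_eq {V W : Submodule 𝕜 E} [FiniteDimensional 𝕜 V]
    [FiniteDimensional 𝕜 W] (hdim : Module.finrank 𝕜 V = Module.finrank 𝕜 W) {ε : ℝ}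
    (h : ∀ v ∈ V, ‖v‖ = 1 → Metric.infDist v (W : Set E) ≤ ε) {w : E} (hw : w ∈ W)
    (hw1 : ‖w‖ = 1) : Metric.infDist w (V : Set E) ≤ ε := by
  have hε : 0 ≤ ε := by
    have hW : Nontrivial W := ⟨⟨w, hw⟩, 0, fun h0 ↦ by simp_all⟩
    have hV : Nontrivial V :=
      Module.finrank_pos_iff.mp (hdim ▸ Module.finrank_pos_iff.mpr hW)
    obtain ⟨v, hv⟩ := exists_ne (0 : V)
    have hv0 : (v : E) ≠ 0 := by simpa using hv
    exact Metric.infDist_nonneg.trans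
      (h (((‖(v : E)‖ : 𝕜)⁻¹) • (v : E)) (V.smul_mem _ v.2) (norm_smul_inv_norm hv0))
  rcases le_or_gt 1 ε with hε1 | hε1
  · exact (infDist_le_norm V w).trans (hw1.trans_le hε1)
  have hc : 0 < 1 - ε ^ 2 := by nlinarith
  let T : V →ₗ[𝕜] W := W.orthogonalProjectionOnto.toLinearMap ∘ₗ V.subtype
  have hT : Function.Injective T := by
    refine (injective_iff_map_eq_zero T).mpr fun v hv ↦ ?_
    have h0 : W.starProjection (v : E) = 0 := congrArg Subtype.val hv
    have hle := mul_norm_sq_le_norm_starProjection_sq h v.2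
    rw [h0, norm_zero, zero_pow two_ne_zero] at hle
    have hv2 : ‖(v : E)‖ ^ 2 ≤ 0 := nonpos_of_mul_nonpos_right hle hc
    simpa using hv2.antisymm (sq_nonneg _)
  obtain ⟨v, hv⟩ :=
    (LinearMap.injective_iff_surjective_of_finrank_eq_finrank hdim).mp hT ⟨w, hw⟩
  have hvw : W.starProjection (v : E) = w := congrArg Subtype.val hv
  have hle := mul_norm_sq_le_norm_starProjection_sq h v.2
  rw [hvw, hw1] at hle
  have hinner : inner 𝕜 (v : E) (V.starProjection w) = inner 𝕜 w w := by
    rw [← inner_starProjection_left_eq_right, starProjection_eq_self_iff.mpr v.2]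
    nth_rw 1 [← starProjection_eq_self_iff.mpr hw]
    rw [← inner_starProjection_left_eq_right, hvw]
  have hone : 1 ≤ ‖(v : E)‖ * ‖V.starProjection w‖ := by
    have hcs := norm_inner_le_norm (𝕜 := 𝕜) (v : E) (V.starProjection w)
    rwa [hinner, inner_self_eq_norm_sq_to_K, hw1, RCLike.ofReal_one, one_pow, norm_one] at hcs
  have hone2 : 1 ≤ ‖(v : E)‖ ^ 2 * ‖V.starProjection w‖ ^ 2 := by
    rw [← mul_pow]
    exact one_le_pow₀ hone
  refine le_of_sq_le_sq ?_ hε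
  rw [infDist_sq_eq_norm_sq_sub, hw1]
  nlinarith [sq_nonneg ‖V.starProjection w‖]

theorem iSup_infDist_le_of_finrank_eq {V W : Submodule 𝕜 E} [FiniteDimensional 𝕜 V]
    [FiniteDimensional 𝕜 W] (hdim : Module.finrank 𝕜 V = Module.finrank 𝕜 W) :
    (⨆ w : {x : W // ‖x‖ = 1}, Metric.infDist (w.1 : E) (V : Set E)) ≤
      ⨆ v : {x : V // ‖x‖ = 1}, Metric.infDist (v.1 : E) (W : Set E) := by
  have hbdd : BddAbove (Set.range fun v : {x : V // ‖x‖ = 1} ↦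
      Metric.infDist (v.1 : E) (W : Set E)) := by
    refine ⟨1, ?_⟩
    rintro _ ⟨v, rfl⟩
    exact (infDist_le_norm W _).trans_eq v.2
  refine Real.iSup_le (fun w ↦ ?_) (Real.iSup_nonneg fun _ ↦ Metric.infDist_nonneg)
  exact infDist_le_of_finrank_eq hdim
    (fun v hv hv1 ↦ le_ciSup hbdd ⟨⟨v, hv⟩, hv1⟩) w.1.2 w.2

end Submodule


/-- Symmetry of the gap between equal-dimensional subspaces of a finite-dimensional complex
inner product space: the sup over unit vectors of `V` of the distance to `W` equals the sup
over unit vectors of `W` of the distance to `V`; in particular if every unit vector of `V`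
is within `ε` of `W`, then every unit vector of `W` is within `ε` of `V`. -/
theorem stmt_1 {H : Type*} [NormedAddCommGroup H] [InnerProductSpace ℂ H]
    [FiniteDimensional ℂ H] (V W : Submodule ℂ H)
    (hdim : Module.finrank ℂ V = Module.finrank ℂ W) :
    (⨆ v : {x : V // ‖x‖ = 1}, Metric.infDist (v.1 : H) (W : Set H)) =
      (⨆ w : {x : W // ‖x‖ = 1}, Metric.infDist (w.1 : H) (V : Set H)) ∧
    ∀ ε : ℝ, (∀ v : H, v ∈ V → ‖v‖ = 1 → Metric.infDist v (W : Set H) ≤ ε) →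
      ∀ w : H, w ∈ W → ‖w‖ = 1 → Metric.infDist w (V : Set H) ≤ ε := by
  exact ⟨le_antisymm (Submodule.iSup_infDist_le_of_finrank_eq hdim.symm)
    (Submodule.iSup_infDist_le_of_finrank_eq hdim),
    fun _ h _ hw hw1 ↦ Submodule.infDist_le_of_finrank_eq hdim h hw hw1⟩
end

section
/- Let M be a 2×2 complex matrix such that (trace(M)/2)² = det(M) and M is not equal to (trace(M)/2)·I. Then there exist complex numbers α, β, λ with (α, β) ≠ (0, 0) such that M equals the matrix with rows (λ + αβ, α²) and (−β², λ − αβ); necessarily λ = trace(M)/2. -/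
open Matrix

/-- Every 2×2 defective matrix (double eigenvalue `trace M / 2`, not a scalar matrix) can be
written in the canonical parametrized form `[[λ+αβ, α²], [−β², λ−αβ]]` with `(α, β) ≠ (0, 0)`
and `λ = trace M / 2`. -/
theorem stmt_7 (M : Matrix (Fin 2) (Fin 2) ℂ)
    (h1 : (M.trace / 2) ^ 2 = M.det)
    (h2 : M ≠ (M.trace / 2) • (1 : Matrix (Fin 2) (Fin 2) ℂ)) :
    ∃ α β lam : ℂ, ¬(α = 0 ∧ β = 0) ∧
      M = !![lam + α * β, α ^ 2; -β ^ 2, lam - α * β] ∧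
      lam = M.trace / 2 := by
  obtain ⟨α, hα⟩ := IsAlgClosed.exists_pow_nat_eq (M 0 1) two_pos
  obtain ⟨γ, hγ⟩ := IsAlgClosed.exists_pow_nat_eq (-M 1 0) two_pos
  rw [trace_fin_two, det_fin_two] at h1
  have hsq : (α * γ) ^ 2 = ((M 0 0 - M 1 1) / 2) ^ 2 := by
    rw [mul_pow, hα, hγ]
    linear_combination -h1
  obtain ⟨β, hβ, hαβ⟩ : ∃ β : ℂ, β ^ 2 = -M 1 0 ∧ α * β = (M 0 0 - M 1 1) / 2 := by
    rcases sq_eq_sq_iff_eq_or_eq_neg.mp hsq with h | h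
    · exact ⟨γ, hγ, h⟩
    · exact ⟨-γ, by rw [neg_sq, hγ], by linear_combination -h⟩
  have hM : M = !![M.trace / 2 + α * β, α ^ 2; -β ^ 2, M.trace / 2 - α * β] := by
    rw [hα, hβ, hαβ, trace_fin_two]
    ext i j
    fin_cases i <;> fin_cases j <;> simp <;> ring
  refine ⟨α, β, M.trace / 2, ?_, hM, rfl⟩
  rintro ⟨rfl, rfl⟩
  refine h2 (hM.trans ?_)
  ext i j
  fin_cases i <;> fin_cases j <;> simp
end

section
/- Let A be an n×n real matrix, let u₁, u₂ ∈ ℝⁿ be orthonormal vectors with A u₁ = s₁₁ u₁, let s₁₂, σ₁₁, σ₁₂, h₁₂ be real numbers, and let λ₁, λ₂ ∈ ℝⁿ satisfy (Aᵀ − s₁₁ I) λ₁ = s₁₂ λ₂ − 2σ₁₁ u₁ − σ₁₂ u₂ and u₁ᵀ λ₂ = −h₁₂. Then σ₁₁ = −h₁₂ s₁₂ / 2. -/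
open Matrix

/-- Adjoint-method identity: taking the dot product of the `λ₁` adjoint equation with `u₁`
yields `σ₁₁ = −h₁₂ s₁₂ / 2`. -/
theorem stmt_17 {n : ℕ} (A : Matrix (Fin n) (Fin n) ℝ) (u₁ u₂ lam1 lam2 : Fin n → ℝ)
    (s11 s12 sig11 sig12 h12 : ℝ)
    (hu1 : u₁ ⬝ᵥ u₁ = 1) (hu2 : u₂ ⬝ᵥ u₂ = 1) (horth : u₁ ⬝ᵥ u₂ = 0)
    (heig : A *ᵥ u₁ = s11 • u₁)
    (hadj : (Aᵀ - s11 • (1 : Matrix (Fin n) (Fin n) ℝ)) *ᵥ lam1 =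
      s12 • lam2 - (2 * sig11) • u₁ - sig12 • u₂)
    (hnorm : u₁ ⬝ᵥ lam2 = -h12) :
    sig11 = -h12 * s12 / 2 := by
  have hdot := congrArg (u₁ ⬝ᵥ ·) hadj
  simp only [sub_mulVec, smul_mulVec, one_mulVec, dotProduct_sub, dotProduct_smul,
    dotProduct_mulVec, vecMul_transpose, heig, smul_dotProduct, smul_eq_mul,
    hu1, horth, hnorm] at hdot
  linarith
end

section
/- Let A be an n×n real matrix, let u₁, u₂ ∈ ℝⁿ be orthonormal vectors, with A u₂ = s₁₂ u₁ + s₂₂ u₂ for real s₁₂, s₂₂, let σ₁₂, σ₂₂, h₁₂ be real numbers, and let λ₂ ∈ ℝⁿ satisfy (Aᵀ − s₂₂ I) λ₂ = −σ₁₂ u₁ − 2σ₂₂ u₂ and u₁ᵀ λ₂ = −h₁₂. Then σ₂₂ = h₁₂ s₁₂ / 2. -/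
open Matrix

/-- Adjoint-method identity: taking the dot product of the `λ₂` adjoint equation with `u₂`
yields `σ₂₂ = h₁₂ s₁₂ / 2`. -/
theorem stmt_18 {n : ℕ} (A : Matrix (Fin n) (Fin n) ℝ) (u₁ u₂ lam2 : Fin n → ℝ)
    (s12 s22 sig12 sig22 h12 : ℝ)
    (hu1 : u₁ ⬝ᵥ u₁ = 1) (hu2 : u₂ ⬝ᵥ u₂ = 1) (horth : u₁ ⬝ᵥ u₂ = 0)
    (heig : A *ᵥ u₂ = s12 • u₁ + s22 • u₂)
    (hadj : (Aᵀ - s22 • (1 : Matrix (Fin n) (Fin n) ℝ)) *ᵥ lam2 =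
      -(sig12 • u₁) - (2 * sig22) • u₂)
    (hnorm : u₁ ⬝ᵥ lam2 = -h12) :
    sig22 = h12 * s12 / 2 := by
  have h := congrArg (u₂ ⬝ᵥ ·) hadj
  have htr : u₂ ⬝ᵥ Aᵀ *ᵥ lam2 = (A *ᵥ u₂) ⬝ᵥ lam2 := by
    rw [dotProduct_mulVec, vecMul_transpose]
  have horth' : u₂ ⬝ᵥ u₁ = 0 := by rw [dotProduct_comm, horth]
  simp only [sub_mulVec, smul_mulVec, one_mulVec, dotProduct_sub, dotProduct_neg,
    dotProduct_smul, htr, heig, add_dotProduct, smul_dotProduct, smul_eq_mul, hu2, horth',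
    hnorm] at h
  linarith
end

section
/- Let A be an n×n real matrix, let u₁, u₂ ∈ ℝⁿ be orthonormal vectors with A u₁ = s₁₁ u₁ for real s₁₁, let s₂₂, σ₁₂, σ₂₂, h₁₂ be real numbers, and let λ₂ ∈ ℝⁿ satisfy (Aᵀ − s₂₂ I) λ₂ = −σ₁₂ u₁ − 2σ₂₂ u₂ and u₁ᵀ λ₂ = −h₁₂. Then σ₁₂ = (s₁₁ − s₂₂) h₁₂. -/
open Matrix

/-- Adjoint-method identity: taking the dot product of the `λ₂` adjoint equation with `u₁`
yields `σ₁₂ = (s₁₁ − s₂₂) h₁₂`. -/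
theorem stmt_19 {n : ℕ} (A : Matrix (Fin n) (Fin n) ℝ) (u₁ u₂ lam2 : Fin n → ℝ)
    (s11 s22 sig12 sig22 h12 : ℝ)
    (hu1 : u₁ ⬝ᵥ u₁ = 1) (hu2 : u₂ ⬝ᵥ u₂ = 1) (horth : u₁ ⬝ᵥ u₂ = 0)
    (heig : A *ᵥ u₁ = s11 • u₁)
    (hadj : (Aᵀ - s22 • (1 : Matrix (Fin n) (Fin n) ℝ)) *ᵥ lam2 =
      -(sig12 • u₁) - (2 * sig22) • u₂)
    (hnorm : u₁ ⬝ᵥ lam2 = -h12) :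
    sig12 = (s11 - s22) * h12 := by
  have hA : u₁ ⬝ᵥ (Aᵀ *ᵥ lam2) = s11 * (u₁ ⬝ᵥ lam2) := by
    rw [dotProduct_mulVec, vecMul_transpose, heig, smul_dotProduct, smul_eq_mul]
  have h := congrArg (u₁ ⬝ᵥ ·) hadj
  simp only [sub_mulVec, smul_mulVec, one_mulVec, dotProduct_sub, dotProduct_neg,
    dotProduct_smul, smul_eq_mul, hA, hu1, horth, hnorm] at h
  linarith
end
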